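/- Let n ≥ 1 be an integer and let x, y be real numbers with x ≠ y. Then Σ_{k=1}^{n} (B_k(x)/k) E_{n-k}(y) − H_n E_n(y) − (E_n(x) − E_n(y))/(x−y) = Σ_{l=1}^{n} C(n, l) · ((B_l(x−y)/l) E_{n-l}(y) − (E_{l-1}(y−x)/2) E_{n-l}(x)). -/

import Mathlib

open Finset

/-- The `n`-th Bernoulli polynomial evaluated at a real `x`:
`B_n(x) = ∑_{k=0}^n (n choose k) B_k x^(n-k)`, where `B_k` is the `k`-th Bernoulli number
(with the convention `B_1 = -1/2`, i.e. generating function `z e^{xz}/(e^z - 1)`). -/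
noncomputable def bernoulliPoly (n : ℕ) (x : ℝ) : ℝ :=
  ∑ k ∈ Finset.range (n + 1), ((bernoulli k : ℚ) : ℝ) * (n.choose k : ℝ) * x ^ (n - k)

/-- The `n`-th harmonic number `H_n = ∑_{k=1}^n 1/k` as a real number. -/
noncomputable def harm (n : ℕ) : ℝ :=
  ∑ k ∈ Finset.range n, (1 : ℝ) / (k + 1)

/-- The `n`-th Euler polynomial evaluated at a real `x`, defined via the classical identity
`E_n(x) = (2/(n+1)) * (B_{n+1}(x) - 2^{n+1} B_{n+1}(x/2))`, which is equivalent to the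
generating-function definition `2 e^{xz}/(e^z + 1) = ∑ E_n(x) z^n/n!`. -/
noncomputable def eulerPoly (n : ℕ) (x : ℝ) : ℝ :=
  2 / (n + 1) * (bernoulliPoly (n + 1) x - 2 ^ (n + 1) * bernoulliPoly (n + 1) (x / 2))

open Polynomial in
lemma bP_aeval (n : ℕ) (x : ℝ) : bernoulliPoly n x = aeval x (Polynomial.bernoulli n) := by
  rw [Polynomial.bernoulli, map_sum, bernoulliPoly]
  refine Finset.sum_congr rfl fun k hk => ?_
  have : k ≤ n := by simpa [Nat.lt_succ_iff] using hk
  simp [Polynomial.aeval_monomial]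

lemma bP_shift (n : ℕ) (x : ℝ) :
    bernoulliPoly n (x + 1) = bernoulliPoly n x + n * x ^ (n - 1) := by
  have h := congrArg (Polynomial.aeval x) (Polynomial.bernoulli_comp_one_add_X n)
  simp only [Polynomial.aeval_comp, map_add, map_one, Polynomial.aeval_X, map_nsmul, map_pow] at h
  rw [bP_aeval, bP_aeval, add_comm x 1, h]
  simp

lemma bP_zero (x : ℝ) : bernoulliPoly 0 x = 1 := by simp [bernoulliPoly]

lemma bP_deriv (n : ℕ) (x : ℝ) :
    HasDerivAt (bernoulliPoly (n + 1)) ((n + 1) * bernoulliPoly n x) x := by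
  have h := (Polynomial.bernoulli (n+1)).hasDerivAt_aeval x
  rw [Polynomial.derivative_bernoulli_add_one] at h
  have e : bernoulliPoly (n+1) = fun x => Polynomial.aeval x (Polynomial.bernoulli (n+1)) :=
    funext fun x => bP_aeval _ x
  rw [e, bP_aeval]
  simpa using h

/-- generating series -/
noncomputable def gsA : PowerSeries ℝ :=
  PowerSeries.mk fun k => ((_root_.bernoulli k : ℚ) : ℝ) / (k.factorial : ℝ)

noncomputable def gsE (x : ℝ) : PowerSeries ℝ :=
  PowerSeries.mk fun k => x ^ k / (k.factorial : ℝ)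

lemma gsE_eq (x : ℝ) : gsE x = PowerSeries.rescale x (PowerSeries.exp ℝ) := by
  ext n; simp [gsE, PowerSeries.coeff_rescale, PowerSeries.coeff_exp, div_eq_mul_inv]

lemma gsE_add (x y : ℝ) : gsE (x + y) = gsE x * gsE y := by
  simp only [gsE_eq]; exact (PowerSeries.exp_mul_exp_eq_exp_add x y).symm

lemma bin_conv (a : ℕ → ℝ) (y : ℝ) (n : ℕ) :
    ∑ k ∈ range (n+1), (n.choose k : ℝ) * a k * y ^ (n-k) =
      n.factorial * PowerSeries.coeff n
        ((PowerSeries.mk fun k => a k / (k.factorial : ℝ)) * gsE y) := by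
  rw [PowerSeries.coeff_mul, Finset.Nat.sum_antidiagonal_eq_sum_range_succ_mk, Finset.mul_sum]
  refine Finset.sum_congr rfl fun k hk => ?_
  have hk : k ≤ n := by simpa [Nat.lt_succ_iff] using hk
  rw [Nat.cast_choose ℝ hk]
  simp only [gsE, PowerSeries.coeff_mk]
  field_simp

lemma bP_gs (n : ℕ) (x : ℝ) :
    bernoulliPoly n x = n.factorial * PowerSeries.coeff n (gsA * gsE x) := by
  rw [gsA, ← bin_conv, bernoulliPoly]
  exact Finset.sum_congr rfl fun k _ => by ring

lemma bP_add (n : ℕ) (x y : ℝ) : bernoulliPoly n (x + y) =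
    ∑ k ∈ range (n+1), (n.choose k : ℝ) * bernoulliPoly k x * y ^ (n-k) := by
  rw [bin_conv, bP_gs, gsE_add, ← mul_assoc]
  congr 3
  ext k
  rw [PowerSeries.coeff_mk, bP_gs]
  field_simp

lemma eP_add (n : ℕ) (x y : ℝ) : eulerPoly n (x + y) =
    ∑ k ∈ range (n+1), (n.choose k : ℝ) * eulerPoly k x * y ^ (n-k) := by
  rw [eulerPoly, add_div, bP_add, bP_add, Finset.mul_sum, ← Finset.sum_sub_distrib,
    Finset.sum_range_succ', mul_add, Finset.mul_sum]
  simp only [bP_zero]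
  have h0 : (2:ℝ) ^ (n+1) * ((y/2)^(n+1)) = y^(n+1) := by rw [div_pow]; field_simp
  have : ∀ a b : ℝ, b = 0 → a + b = a := by intros; simp [*]
  rw [this]
  · refine Finset.sum_congr rfl fun k hk => ?_
    have hk : k ≤ n := by simpa [Nat.lt_succ_iff] using hk
    obtain ⟨j, rfl⟩ := Nat.exists_eq_add_of_le hk
    have e1 : k + j + 1 - (k + 1) = j := by omega
    have e2 : k + j - k = j := by omega
    have hc : (((k+j+1 : ℕ) : ℝ)) * ((k+j).choose k : ℝ) = ((k+j+1).choose (k+1)) * ((k+1 : ℕ):ℝ) := by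
      exact_mod_cast Nat.add_one_mul_choose_eq (k+j) k
    have hc' : ((k+j+1).choose (k+1) : ℝ) = ((k+j+1 : ℕ) : ℝ) * ((k+j).choose k : ℝ) / ((k+1 : ℕ):ℝ) := by
      rw [hc]; field_simp
    rw [e1, e2, eulerPoly, hc', div_pow]
    push_cast
    have : (k:ℝ) + j + 1 ≠ 0 := by positivity
    field_simp
    ring
  · simp only [Nat.choose_zero_right, Nat.cast_one, one_mul, Nat.sub_zero]
    rw [h0]; ring

/-- polynomial functions -/
def IsP (f : ℝ → ℝ) : Prop := ∃ p : Polynomial ℝ, ∀ x, f x = p.eval x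

lemma IsP.add {f g : ℝ → ℝ} (hf : IsP f) (hg : IsP g) : IsP (fun x => f x + g x) := by
  obtain ⟨p, hp⟩ := hf; obtain ⟨q, hq⟩ := hg
  exact ⟨p + q, fun x => by simp [hp, hq]⟩
lemma IsP.sub {f g : ℝ → ℝ} (hf : IsP f) (hg : IsP g) : IsP (fun x => f x - g x) := by
  obtain ⟨p, hp⟩ := hf; obtain ⟨q, hq⟩ := hg
  exact ⟨p - q, fun x => by simp [hp, hq]⟩
lemma IsP.mul {f g : ℝ → ℝ} (hf : IsP f) (hg : IsP g) : IsP (fun x => f x * g x) := by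
  obtain ⟨p, hp⟩ := hf; obtain ⟨q, hq⟩ := hg
  exact ⟨p * q, fun x => by simp [hp, hq]⟩
lemma IsP.const (c : ℝ) : IsP (fun _ => c) := ⟨Polynomial.C c, fun x => by simp⟩
lemma IsP.div {f : ℝ → ℝ} (hf : IsP f) (c : ℝ) : IsP (fun x => f x / c) := by
  simp only [div_eq_mul_inv]; exact hf.mul (IsP.const _)
lemma IsP.id : IsP (fun x => x) := ⟨Polynomial.X, fun x => by simp⟩
lemma IsP.comp {f g : ℝ → ℝ} (hf : IsP f) (hg : IsP g) : IsP (fun x => f (g x)) := by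
  obtain ⟨p, hp⟩ := hf; obtain ⟨q, hq⟩ := hg
  exact ⟨p.comp q, fun x => by simp [hp, hq]⟩
lemma IsP.sum {ι : Type} (s : Finset ι) {f : ι → ℝ → ℝ} (hf : ∀ i, IsP (f i)) :
    IsP (fun x => ∑ i ∈ s, f i x) := by
  choose p hp using hf
  exact ⟨∑ i ∈ s, p i, fun x => by simp [hp, Polynomial.eval_finsetSum]⟩
lemma IsP.bP (n : ℕ) : IsP (bernoulliPoly n) :=
  ⟨(Polynomial.bernoulli n).map (algebraMap ℚ ℝ), fun x => by
    rw [bP_aeval, Polynomial.eval_map_algebraMap]⟩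
lemma IsP.eP (n : ℕ) : IsP (eulerPoly n) := by
  unfold eulerPoly
  exact (IsP.const _).mul ((IsP.bP _).sub ((IsP.const _).mul ((IsP.bP _).comp (IsP.id.div 2))))

lemma IsP.periodic {f : ℝ → ℝ} (hf : IsP f) (c : ℝ) (hc : 0 < c) (h : ∀ x, f (x + c) = f x) (x : ℝ) :
    f x = f 0 := by
  obtain ⟨p, hp⟩ := hf
  have hn : ∀ m : ℕ, f (m * c) = f 0 := by
    intro m
    induction m with
    | zero => simp
    | succ m ih => rw [← ih, ← h (m * c)]; congr 1; push_cast; ring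
  have : p = Polynomial.C (f 0) := by
    apply Polynomial.eq_of_infinite_eval_eq
    refine Set.Infinite.mono (s := Set.range fun m : ℕ => (m:ℝ) * c) ?_ ?_
    · rintro _ ⟨m, rfl⟩
      simp [← hp, hn]
    · apply Set.infinite_range_of_injective
      intro a b hab
      simpa [hc.ne'] using hab
  rw [hp x, this]; simp

lemma bP_mult (n : ℕ) (x : ℝ) :
    2 ^ n * (bernoulliPoly n (x/2) + bernoulliPoly n (x/2 + 1/2)) = 2 * bernoulliPoly n x := by
  let g : ℝ → ℝ := fun x => 2 ^ (n+1) * (bernoulliPoly (n+1) (x/2) + bernoulliPoly (n+1) (x/2 + 1/2))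
      - 2 * bernoulliPoly (n+1) x
  have hg : IsP g := ((IsP.const _).mul (((IsP.bP _).comp (IsP.id.div 2)).add
    ((IsP.bP _).comp ((IsP.id.div 2).add (IsP.const _))))).sub ((IsP.const _).mul (IsP.bP _))
  have hper : ∀ x, g (x + 1) = g x := by
    intro x
    have e1 : (x+1)/2 = x/2 + 1/2 := by ring
    have e2 : x/2 + 1/2 + 1/2 = x/2 + 1 := by ring
    simp only [g]
    rw [e1, e2, bP_shift, bP_shift]
    simp only [Nat.add_sub_cancel, div_pow]
    field_simp
    ring
  have hc : g = fun _ => g 0 := funext fun x => hg.periodic 1 one_pos hper x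
  have d1 : HasDerivAt g 0 x := by rw [hc]; exact hasDerivAt_const _ _
  have i1 : HasDerivAt (fun x : ℝ => x/2) (1/2) x := (hasDerivAt_id x).div_const 2
  have i2 : HasDerivAt (fun x : ℝ => x/2+1/2) (1/2) x := i1.add_const _
  have d2 : HasDerivAt g _ x :=
    ((((bP_deriv n (x/2)).comp x i1).add ((bP_deriv n (x/2+1/2)).comp x i2)).const_mul
      ((2:ℝ)^(n+1))).sub ((bP_deriv n x).const_mul 2)
  have := d1.unique d2
  have hn : (n:ℝ) + 1 ≠ 0 := by positivity
  apply mul_left_cancel₀ hn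
  rw [pow_succ] at this
  linarith

lemma eP_shift (n : ℕ) (x : ℝ) : eulerPoly n (x + 1) = 2 * x ^ n - eulerPoly n x := by
  have h := bP_mult (n+1) x
  rw [← add_div] at h
  rw [eulerPoly, eulerPoly, bP_shift]
  have hn : (n:ℝ) + 1 ≠ 0 := by positivity
  rw [Nat.add_sub_cancel]
  push_cast
  field_simp
  linarith

lemma S1 (n : ℕ) (y d : ℝ) :
    ∑ k ∈ range n, bernoulliPoly (k+1) (y+d) / ((k+1 : ℕ) : ℝ) * y ^ (n-(k+1)) =
    harm n * y ^ n + ∑ l ∈ range n, (n.choose (l+1) : ℝ) * (bernoulliPoly (l+1) d / ((l+1 : ℕ) : ℝ)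
      * y ^ (n-(l+1))) := by
  induction n with
  | zero => simp [harm]
  | succ n ih =>
    have hL : ∑ k ∈ range n, bernoulliPoly (k+1) (y+d) / ((k+1 : ℕ) : ℝ) * y ^ (n+1-(k+1)) =
        y * ∑ k ∈ range n, bernoulliPoly (k+1) (y+d) / ((k+1 : ℕ) : ℝ) * y ^ (n-(k+1)) := by
      rw [Finset.mul_sum]
      refine Finset.sum_congr rfl fun k hk => ?_
      have hk := Finset.mem_range.1 hk
      rw [show n + 1 - (k+1) = n - (k+1) + 1 by omega, pow_succ]; ring
    have hR : ∑ l ∈ range (n+1), (n.choose (l+1) : ℝ) * (bernoulliPoly (l+1) d / ((l+1 : ℕ) : ℝ)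
          * y ^ (n+1-(l+1))) =
        y * ∑ l ∈ range n, (n.choose (l+1) : ℝ) * (bernoulliPoly (l+1) d / ((l+1 : ℕ) : ℝ)
          * y ^ (n-(l+1))) := by
      rw [Finset.sum_range_succ, Nat.choose_succ_self, Finset.mul_sum]
      simp only [Nat.cast_zero, zero_mul, add_zero]
      refine Finset.sum_congr rfl fun k hk => ?_
      have hk := Finset.mem_range.1 hk
      rw [show n + 1 - (k+1) = n - (k+1) + 1 by omega, pow_succ]; ring
    have hB : bernoulliPoly (n+1) (y+d) / ((n+1 : ℕ) : ℝ) = y^(n+1) / ((n+1 : ℕ) : ℝ) +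
        ∑ l ∈ range (n+1), (n.choose l : ℝ) * (bernoulliPoly (l+1) d / ((l+1 : ℕ) : ℝ)
          * y ^ (n+1-(l+1))) := by
      rw [add_comm y d, bP_add, Finset.sum_range_succ', add_div, Finset.sum_div, add_comm]
      congr 1
      · simp [bP_zero]
      · refine Finset.sum_congr rfl fun k hk => ?_
        have hc : (((n+1 : ℕ) : ℝ)) * (n.choose k : ℝ) = ((n+1).choose (k+1)) * ((k+1 : ℕ):ℝ) := by
          exact_mod_cast Nat.add_one_mul_choose_eq n k
        have hc' : ((n+1).choose (k+1) : ℝ) = ((n+1 : ℕ) : ℝ) * (n.choose k : ℝ) / ((k+1 : ℕ):ℝ) := by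
          rw [hc]; field_simp
        rw [hc']
        field_simp
    rw [Finset.sum_range_succ, hL, ih]
    simp only [Nat.choose_succ_succ' n, Nat.cast_add (n.choose _), add_mul, Finset.sum_add_distrib]
    have hH : harm (n+1) = harm n + 1 / (n + 1) := by simp [harm, Finset.sum_range_succ]
    rw [hR, Nat.sub_self, pow_zero, mul_one, hB, hH]
    push_cast
    ring

lemma S2 (n : ℕ) (x c : ℝ) :
    ∑ k ∈ range n, x ^ k * eulerPoly (n-(k+1)) (x+c) =
    ∑ l ∈ range n, (n.choose (l+1) : ℝ) * (eulerPoly l c * x ^ (n-(l+1))) := by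
  induction n with
  | zero => simp
  | succ n ih =>
    have hR : ∑ l ∈ range (n+1), (n.choose (l+1) : ℝ) * (eulerPoly l c * x ^ (n+1-(l+1))) =
        x * ∑ l ∈ range n, (n.choose (l+1) : ℝ) * (eulerPoly l c * x ^ (n-(l+1))) := by
      rw [Finset.sum_range_succ, Nat.choose_succ_self, Finset.mul_sum]
      simp only [Nat.cast_zero, zero_mul, add_zero]
      refine Finset.sum_congr rfl fun k hk => ?_
      have hk := Finset.mem_range.1 hk
      rw [show n + 1 - (k+1) = n - (k+1) + 1 by omega, pow_succ]; ring
    simp only [Nat.choose_succ_succ' n, Nat.cast_add (n.choose _), add_mul, Finset.sum_add_distrib]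
    have hE : x ^ 0 * eulerPoly (n + 1 - (0+1)) (x+c) =
        ∑ l ∈ range (n+1), (n.choose l : ℝ) * (eulerPoly l c * x ^ (n+1-(l+1))) := by
      rw [add_comm x c, eP_add]
      simp [mul_assoc]
    have hT : ∑ k ∈ range n, x ^ (k+1) * eulerPoly (n+1-(k+1+1)) (x+c) =
        x * ∑ k ∈ range n, x ^ k * eulerPoly (n-(k+1)) (x+c) := by
      rw [Finset.mul_sum]
      refine Finset.sum_congr rfl fun k hk => ?_
      rw [show n + 1 - (k+1+1) = n - (k+1) by omega, pow_succ]; ring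
    rw [hR, ← ih, Finset.sum_range_succ', hE, hT, add_comm]

lemma icc_range (n : ℕ) (f : ℕ → ℝ) : ∑ k ∈ Finset.Icc 1 n, f k = ∑ k ∈ range n, f (k+1) := by
  induction n with
  | zero => simp
  | succ n ih => rw [Finset.sum_range_succ, ← ih, Finset.sum_Icc_succ_top (by omega)]

theorem stmt_10 (n : ℕ) (hn : 1 ≤ n) (x y : ℝ) (hxy : x ≠ y) :
    (∑ k ∈ Finset.Icc 1 n, bernoulliPoly k x / (k : ℝ) * eulerPoly (n - k) y) -
      harm n * eulerPoly n y - (eulerPoly n x - eulerPoly n y) / (x - y) =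
    ∑ l ∈ Finset.Icc 1 n, (n.choose l : ℝ) *
      (bernoulliPoly l (x - y) / (l : ℝ) * eulerPoly (n - l) y -
        eulerPoly (l - 1) (y - x) / 2 * eulerPoly (n - l) x) := by
  obtain ⟨d, rfl⟩ : ∃ d, x = y + d := ⟨x - y, by ring⟩
  have hd : d ≠ 0 := by rintro rfl; simp at hxy
  have e1 : y + d - y = d := by ring
  have e2 : y - (y + d) = -d := by ring
  rw [e1, e2, icc_range, icc_range]
  simp only [Nat.add_sub_cancel]
  let F : ℝ → ℝ := fun y =>
    ((∑ k ∈ range n, bernoulliPoly (k+1) (y+d) / ((k+1 : ℕ) : ℝ) * eulerPoly (n - (k+1)) y) -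
      harm n * eulerPoly n y - (eulerPoly n (y+d) - eulerPoly n y) / d) -
    ∑ l ∈ range n, (n.choose (l+1) : ℝ) *
      (bernoulliPoly (l+1) d / ((l+1 : ℕ) : ℝ) * eulerPoly (n - (l+1)) y -
        eulerPoly l (-d) / 2 * eulerPoly (n - (l+1)) (y+d))
  have hs : IsP (fun y => y + d) := IsP.id.add (IsP.const d)
  have hF : IsP F := by
    refine IsP.sub (((IsP.sum _ fun k => (((IsP.bP _).comp hs).div _).mul (IsP.eP _)).sub
      ((IsP.const _).mul (IsP.eP _))).sub ((((IsP.eP _).comp hs).sub (IsP.eP _)).div _)) ?_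
    exact IsP.sum _ fun l => (IsP.const _).mul (((IsP.const _).mul (IsP.eP _)).sub
      ((IsP.const _).mul ((IsP.eP _).comp hs)))
  have key : ∀ y, F (y + 1) = - F y := by
    intro y
    have h1 := S1 n y d
    have h2 := S2 n (y+d) (-d)
    rw [show y + d + -d = y by ring] at h2
    have h3 : ((y+d)^n - y^n) / d = ∑ k ∈ range n, (y+d)^k * y^(n-(k+1)) := by
      have := (Commute.all (y+d) y).geom_sum₂_mul n
      rw [show y + d - y = d by ring] at this
      rw [← this, mul_div_assoc, div_self hd, mul_one]
      exact Finset.sum_congr rfl fun k _ => by rw [Nat.sub_sub, add_comm 1 k]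
    have hA : (∑ k ∈ range n, bernoulliPoly (k+1) (y+1+d) / ((k+1 : ℕ) : ℝ) * eulerPoly (n - (k+1)) (y+1))
       = 2 * (∑ k ∈ range n, bernoulliPoly (k+1) (y+d) / ((k+1 : ℕ) : ℝ) * y ^ (n-(k+1)))
         + 2 * (∑ k ∈ range n, (y+d)^k * y^(n-(k+1)))
         - (∑ k ∈ range n, (y+d) ^ k * eulerPoly (n-(k+1)) y)
         - (∑ k ∈ range n, bernoulliPoly (k+1) (y+d) / ((k+1 : ℕ) : ℝ) * eulerPoly (n - (k+1)) y) := by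
      simp only [Finset.mul_sum, ← Finset.sum_add_distrib, ← Finset.sum_sub_distrib]
      refine Finset.sum_congr rfl fun k _ => ?_
      rw [show y + 1 + d = y + d + 1 by ring, bP_shift, eP_shift, Nat.add_sub_cancel]
      field_simp
      ring
    have hB : (∑ l ∈ range n, (n.choose (l+1) : ℝ) *
      (bernoulliPoly (l+1) d / ((l+1 : ℕ) : ℝ) * eulerPoly (n - (l+1)) (y+1) -
        eulerPoly l (-d) / 2 * eulerPoly (n - (l+1)) (y+1+d))) =
        2 * (∑ l ∈ range n, (n.choose (l+1) : ℝ) * (bernoulliPoly (l+1) d / ((l+1 : ℕ) : ℝ)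
          * y ^ (n-(l+1))))
        - (∑ l ∈ range n, (n.choose (l+1) : ℝ) * (eulerPoly l (-d) * (y+d) ^ (n-(l+1))))
        - (∑ l ∈ range n, (n.choose (l+1) : ℝ) *
      (bernoulliPoly (l+1) d / ((l+1 : ℕ) : ℝ) * eulerPoly (n - (l+1)) y -
        eulerPoly l (-d) / 2 * eulerPoly (n - (l+1)) (y+d))) := by
      simp only [Finset.mul_sum, ← Finset.sum_add_distrib, ← Finset.sum_sub_distrib]
      refine Finset.sum_congr rfl fun k _ => ?_
      rw [show y + 1 + d = y + d + 1 by ring, eP_shift, eP_shift]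
      ring
    have hC : (eulerPoly n (y+1+d) - eulerPoly n (y+1)) / d = 2 * (((y+d)^n - y^n) / d)
        - (eulerPoly n (y+d) - eulerPoly n y) / d := by
      rw [show y + 1 + d = y + d + 1 by ring, eP_shift, eP_shift]
      ring
    simp only [F]
    rw [hA, hB, hC, h1, h2, h3, eP_shift]
    ring
  have h0 : ∀ y, F y = F 0 := hF.periodic 2 two_pos fun y => by
    rw [show y + 2 = y + 1 + 1 by ring, key, key, neg_neg]
  have h1 := key 0
  rw [h0] at h1
  have h2 : F y = 0 := by rw [h0]; linarith
  exact sub_eq_zero.1 h2
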